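/- If Duplicator wins the slope game from position ((p,p'),(ρ,ρ')), then Duplicator wins the simulation game from every position (pm, p'm') such that (m,m') is C-above (ρ,ρ'), where C is 1 plus the maximal length of an acyclic path in the product graph of the two nets. -/

import Mathlib

/-- A one-counter net over control states `Q` and actions `A`:
transitions carry a counter effect in `{-1, 0, 1}`. -/
structure OCN (Q A : Type) where
  δ : Q → A → ℤ → Q → Prop
  effect_bounded : ∀ p a d q, δ p a d q → d = -1 ∨ d = 0 ∨ d = 1

namespace OCN

/-- The step relation of the LTS induced by a one-counter net on
configurations `Q × ℕ`:  `(p,m) →a (q,n)` iff there is a transition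
`(p,a,d,q)` with `n = m + d ≥ 0`. -/
def Step {Q A : Type} (N : OCN Q A) (c : Q × ℕ) (a : A) (c' : Q × ℕ) : Prop :=
  ∃ d : ℤ, N.δ c.1 a d c'.1 ∧ (c'.2 : ℤ) = (c.2 : ℤ) + d

/-- An OCN is complete if every state has an `a`-labelled outgoing transition
for every action `a`. -/
def Complete {Q A : Type} (N : OCN Q A) : Prop :=
  ∀ p a, ∃ d q, N.δ p a d q

/-- An OCN is non-blocking if every state has an outgoing transition with
counter effect in `{0, 1}`. -/
def NonBlocking {Q A : Type} (N : OCN Q A) : Prop :=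
  ∀ p, ∃ a d q, N.δ p a d q ∧ (d = 0 ∨ d = 1)

end OCN

/-- `R` is a strong simulation between two labelled transition systems. -/
def IsSimulation {S S' A : Type} (stepL : S → A → S → Prop) (stepR : S' → A → S' → Prop)
    (R : S → S' → Prop) : Prop :=
  ∀ c c', R c c' → ∀ a d, stepL c a d → ∃ d', stepR c' a d' ∧ R d d'

/-- The strong simulation preorder `⪯`: the largest strong simulation,
i.e. the union of all strong simulations. -/
def Simulates {S S' A : Type} (stepL : S → A → S → Prop) (stepR : S' → A → S' → Prop)
    (c : S) (c' : S') : Prop :=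
  ∃ R, IsSimulation stepL stepR R ∧ R c c'

/-- A vector `(ρ,ρ')` is positive if both components are nonnegative and it
is not the zero vector. -/
def PosVec (ρ ρ' : ℝ) : Prop := 0 ≤ ρ ∧ 0 ≤ ρ' ∧ ¬(ρ = 0 ∧ ρ' = 0)

/-- `(α,α')` is behind `(ρ,ρ')`: the clockwise angle from `(ρ,ρ')` to
`(α,α')` is strictly between 0° and 180°, equivalently the cross product
`ρ·α' − ρ'·α` is strictly negative. -/
def Behind (ρ ρ' α α' : ℝ) : Prop := ρ * α' - ρ' * α < 0

/-- The point `(n,n')` is `c`-above the vector `(ρ,ρ')`. -/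
def CAbove (c ρ ρ' : ℝ) (n n' : ℤ) : Prop :=
  ∃ r : ℝ, 0 < r ∧ (n : ℝ) < r * ρ - c ∧ r * ρ' + c < (n' : ℝ)

/-- The point `(n,n')` is `c`-below the vector `(ρ,ρ')`. -/
def CBelow (c ρ ρ' : ℝ) (n n' : ℤ) : Prop :=
  ∃ r : ℝ, 0 < r ∧ r * ρ + c < (n : ℝ) ∧ (n' : ℝ) < r * ρ' - c

/-- A step in the product graph of two OCNs: a common action label, the two
counter effects, and the target node. -/
abbrev PStep (Q Q' A : Type) := A × ℤ × ℤ × (Q × Q')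

/-- Target node of a product-graph step. -/
def stepTgt {Q Q' A : Type} (s : PStep Q Q' A) : Q × Q' := s.2.2.2

/-- End node of a path given by a source node and a list of steps. -/
def pathEnd {Q Q' A : Type} (v : Q × Q') : List (PStep Q Q' A) → Q × Q'
  | [] => v
  | s :: rest => pathEnd (stepTgt s) rest

/-- The list of nodes visited by a path. -/
def pathNodes {Q Q' A : Type} (v : Q × Q') (steps : List (PStep Q Q' A)) :
    List (Q × Q') :=
  v :: steps.map stepTgt

/-- Validity of a path in the product graph of `N` and `N'`: every step is a
pair of equally labelled transitions of the two nets. -/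
def IsProdPath {Q Q' A : Type} (N : OCN Q A) (N' : OCN Q' A) :
    Q × Q' → List (PStep Q Q' A) → Prop
  | _, [] => True
  | v, s :: rest =>
      N.δ v.1 s.1 s.2.1 (stepTgt s).1 ∧ N'.δ v.2 s.1 s.2.2.1 (stepTgt s).2 ∧
      IsProdPath N N' (stepTgt s) rest

/-- The set of numbers of the form (length of an acyclic path in the product
graph) + 1; its greatest element is the constant `C` of the Belt Theorem. -/
def AcyclicLenSet {Q Q' A : Type} (N : OCN Q A) (N' : OCN Q' A) : Set ℕ :=
  {k | ∃ v steps, IsProdPath N N' v steps ∧ (pathNodes v steps).Nodup ∧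
        steps.length + 1 = k}

/-- A path is a lasso if it contains a cycle while no strict prefix does:
all nodes but the last one are pairwise distinct, and the last node repeats
an earlier one. -/
def IsLasso {Q Q' A : Type} (v : Q × Q') (steps : List (PStep Q Q' A)) : Prop :=
  steps ≠ [] ∧ (pathNodes v steps.dropLast).Nodup ∧
    pathEnd v steps ∈ pathNodes v steps.dropLast

/-- The pair of cumulative counter effects (Spoiler side, Duplicator side)
of a list of product-graph steps. -/
def effectsOf {Q Q' A : Type} (steps : List (PStep Q Q' A)) : ℤ × ℤ :=
  ((steps.map fun s => s.2.1).sum, (steps.map fun s => s.2.2.1).sum)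

/-- Duplicator has a winning strategy in the slope game from the position
given by the current path `(v, steps)` of the phase and the current slope
`(ρ, ρ')`: there is a set `W` of positions containing it and closed under
rounds of the game, i.e. from a position in `W`, for every Spoiler transition
Duplicator has an equally labelled response transition such that: if the
extended path is not a lasso, the extended position is again in `W`; and if
it is a lasso, with cycle `cyc`, then whenever the cycle effect is behind the
slope (otherwise Duplicator has won immediately) it is positive and the new
phase position, at the final node with the cycle effect as new slope, is
again in `W`. -/
def SlopeDupWins {Q Q' A : Type} (N : OCN Q A) (N' : OCN Q' A)
    (v₀ : Q × Q') (steps₀ : List (PStep Q Q' A)) (σ σ' : ℝ) : Prop :=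
  ∃ W : Q × Q' → List (PStep Q Q' A) → ℝ → ℝ → Prop,
    W v₀ steps₀ σ σ' ∧
    ∀ v steps ρ ρ', W v steps ρ ρ' →
      ∀ (a : A) (d : ℤ) (p : Q), N.δ (pathEnd v steps).1 a d p →
        ∃ (d' : ℤ) (p' : Q'), N'.δ (pathEnd v steps).2 a d' p' ∧
          (¬ IsLasso v (steps ++ [(a, d, d', (p, p'))]) →
            W v (steps ++ [(a, d, d', (p, p'))]) ρ ρ') ∧
          (IsLasso v (steps ++ [(a, d, d', (p, p'))]) →
            ∀ pre cyc, steps ++ [(a, d, d', (p, p'))] = pre ++ cyc →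
              cyc ≠ [] →
              pathEnd v pre = pathEnd v (steps ++ [(a, d, d', (p, p'))]) →
              Behind ρ ρ' ((effectsOf cyc).1 : ℝ) ((effectsOf cyc).2 : ℝ) →
                PosVec ((effectsOf cyc).1 : ℝ) ((effectsOf cyc).2 : ℝ) ∧
                W (p, p') [] ((effectsOf cyc).1 : ℝ) ((effectsOf cyc).2 : ℝ))

section Helpers
variable {Q Q' A : Type}

lemma pathEnd_append (v : Q × Q') (l l' : List (PStep Q Q' A)) :
    pathEnd v (l ++ l') = pathEnd (pathEnd v l) l' := by
  induction l generalizing v with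
  | nil => rfl
  | cons s t ih => simp [pathEnd, ih]

lemma pathNodes_append (v : Q × Q') (l l' : List (PStep Q Q' A)) :
    pathNodes v (l ++ l') = pathNodes v l ++ l'.map stepTgt := by
  simp [pathNodes]

lemma isProdPath_append (N : OCN Q A) (N' : OCN Q' A) (v : Q × Q')
    (l l' : List (PStep Q Q' A)) :
    IsProdPath N N' v (l ++ l') ↔ IsProdPath N N' v l ∧ IsProdPath N N' (pathEnd v l) l' := by
  induction l generalizing v with
  | nil => simp [IsProdPath, pathEnd]
  | cons s t ih => simp [IsProdPath, pathEnd, ih, and_assoc]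

lemma effectsOf_append (l l' : List (PStep Q Q' A)) :
    effectsOf (l ++ l') = ((effectsOf l).1 + (effectsOf l').1,
      (effectsOf l).2 + (effectsOf l').2) := by
  simp [effectsOf]

lemma effectsOf_bound (N : OCN Q A) (N' : OCN Q' A) (v : Q × Q')
    (l : List (PStep Q Q' A)) (h : IsProdPath N N' v l) :
    -(l.length : ℤ) ≤ (effectsOf l).1 ∧ (effectsOf l).1 ≤ l.length ∧
    -(l.length : ℤ) ≤ (effectsOf l).2 ∧ (effectsOf l).2 ≤ l.length := by
  induction l generalizing v with
  | nil => simp [effectsOf]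
  | cons s t ih =>
    obtain ⟨h1, h2, h3⟩ := h
    have := ih _ h3
    have a1 := N.effect_bounded _ _ _ _ h1
    have a2 := N'.effect_bounded _ _ _ _ h2
    simp only [effectsOf, List.map_cons, List.sum_cons, List.length_cons] at this ⊢
    push_cast
    omega

lemma mem_pathNodes (v u : Q × Q') (l : List (PStep Q Q' A)) (h : u ∈ pathNodes v l) :
    ∃ pre suf, l = pre ++ suf ∧ pathEnd v pre = u := by
  induction l generalizing v with
  | nil =>
    simp [pathNodes] at h
    exact ⟨[], [], rfl, by simp [pathEnd, h]⟩
  | cons s t ih =>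
    by_cases hu : u = v
    · exact ⟨[], s :: t, rfl, by simp [pathEnd, hu]⟩
    · have : u ∈ pathNodes (stepTgt s) t := by
        simp only [pathNodes, List.map_cons, List.mem_cons] at h ⊢
        tauto
      obtain ⟨pre, suf, h1, h2⟩ := ih _ this
      exact ⟨s :: pre, suf, by simp [h1], by simp [pathEnd, h2]⟩

lemma slopeDupWins_step (N : OCN Q A) (N' : OCN Q' A) (v : Q × Q')
    (steps : List (PStep Q Q' A)) (ρ ρ' : ℝ) (h : SlopeDupWins N N' v steps ρ ρ')
    (a : A) (d : ℤ) (p : Q) (hd : N.δ (pathEnd v steps).1 a d p) :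
    ∃ (d' : ℤ) (p' : Q'), N'.δ (pathEnd v steps).2 a d' p' ∧
      (¬ IsLasso v (steps ++ [(a, d, d', (p, p'))]) →
        SlopeDupWins N N' v (steps ++ [(a, d, d', (p, p'))]) ρ ρ') ∧
      (IsLasso v (steps ++ [(a, d, d', (p, p'))]) →
        ∀ pre cyc, steps ++ [(a, d, d', (p, p'))] = pre ++ cyc →
          cyc ≠ [] →
          pathEnd v pre = pathEnd v (steps ++ [(a, d, d', (p, p'))]) →
          Behind ρ ρ' ((effectsOf cyc).1 : ℝ) ((effectsOf cyc).2 : ℝ) →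
            PosVec ((effectsOf cyc).1 : ℝ) ((effectsOf cyc).2 : ℝ) ∧
            SlopeDupWins N N' (p, p') [] ((effectsOf cyc).1 : ℝ) ((effectsOf cyc).2 : ℝ)) := by
  obtain ⟨W, hW, hc⟩ := h
  obtain ⟨d', p', h1, h2, h3⟩ := hc _ _ _ _ hW a d p hd
  refine ⟨d', p', h1, fun hl => ⟨W, h2 hl, hc⟩, fun hl pre cyc e1 e2 e3 e4 => ?_⟩
  obtain ⟨g1, g2⟩ := h3 hl pre cyc e1 e2 e3 e4
  exact ⟨g1, W, g2, hc⟩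

/-- acyclic path all of whose prefixes are winning -/
def RPath (N : OCN Q A) (N' : OCN Q' A) (v : Q × Q') (steps : List (PStep Q Q' A))
    (ρ ρ' : ℝ) : Prop :=
  IsProdPath N N' v steps ∧ (pathNodes v steps).Nodup ∧
    ∀ pre suf, steps = pre ++ suf → SlopeDupWins N N' v pre ρ ρ'

/-- weight -/
noncomputable def wt (s : ℝ) (l : List (PStep Q Q' A)) : ℝ :=
  ((effectsOf l).2 : ℝ) - s * ((effectsOf l).1 : ℝ)

lemma wt_append (s : ℝ) (l l' : List (PStep Q Q' A)) :
    wt s (l ++ l') = wt s l + wt s l' := by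
  simp only [wt, effectsOf_append]; push_cast; ring

lemma wt_single (s : ℝ) (e : PStep Q Q' A) : wt s [e] = (e.2.2.1 : ℝ) - s * (e.2.1 : ℝ) := by
  simp [wt, effectsOf]

lemma length_lt (N : OCN Q A) (N' : OCN Q' A) (C : ℕ)
    (hC : IsGreatest (AcyclicLenSet N N') C) (v : Q × Q') (l : List (PStep Q Q' A))
    (h : IsProdPath N N' v l) (h' : (pathNodes v l).Nodup) : l.length + 1 ≤ C :=
  hC.2 ⟨v, l, h, h', rfl⟩

lemma RPath.prefix {N : OCN Q A} {N' : OCN Q' A} {v : Q × Q'} {l l' : List (PStep Q Q' A)}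
    {ρ ρ' : ℝ} (h : RPath N N' v (l ++ l') ρ ρ') : RPath N N' v l ρ ρ' := by
  obtain ⟨h1, h2, h3⟩ := h
  refine ⟨((isProdPath_append _ _ _ _ _).1 h1).1, ?_, ?_⟩
  · rw [pathNodes_append] at h2
    exact (List.nodup_append.1 h2).1
  · rintro pre suf rfl
    exact h3 pre (suf ++ l') (by simp)

lemma rpath_step (N : OCN Q A) (N' : OCN Q' A) (C : ℕ)
    (hC : IsGreatest (AcyclicLenSet N N') C) (v : Q × Q')
    (steps : List (PStep Q Q' A)) (ρ ρ' : ℝ) (hρ : 0 < ρ) (hρ' : 0 ≤ ρ')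
    (h : RPath N N' v steps ρ ρ')
    (a : A) (d : ℤ) (p : Q) (hd : N.δ (pathEnd v steps).1 a d p) :
    ∃ (d' : ℤ) (p' : Q'), N'.δ (pathEnd v steps).2 a d' p' ∧
      ((∃ l, RPath N N' v l ρ ρ' ∧ pathEnd v l = (p, p') ∧
          wt (ρ' / ρ) l ≤ wt (ρ' / ρ) steps + (d' - ρ' / ρ * d)) ∨
       (∃ i j : ℕ, 0 < i ∧ i ≤ C ∧ j ≤ C ∧ (j : ℝ) / (i : ℝ) < ρ' / ρ ∧
          RPath N N' (p, p') ([] : List (PStep Q Q' A)) (i : ℝ) (j : ℝ))) := by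
  obtain ⟨h1, h2, h3⟩ := h
  obtain ⟨d', p', g1, g2, g3⟩ := slopeDupWins_step N N' v steps ρ ρ' (h3 steps [] (by simp)) a d p hd
  refine ⟨d', p', g1, ?_⟩
  set e : PStep Q Q' A := (a, d, d', (p, p')) with he
  have hend : pathEnd v (steps ++ [e]) = (p, p') := by
    rw [pathEnd_append]; simp [pathEnd, stepTgt, he]
  have hprod : IsProdPath N N' v (steps ++ [e]) := by
    rw [isProdPath_append]
    exact ⟨h1, hd, g1, trivial⟩
  have hwe : wt (ρ' / ρ) [e] = d' - ρ' / ρ * d := by rw [wt_single]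
  by_cases hmem : (p, p') ∈ pathNodes v steps
  · have hl : IsLasso v (steps ++ [e]) := by
      refine ⟨by simp, ?_, ?_⟩
      · simpa using h2
      · rw [hend]; simpa using hmem
    obtain ⟨pre, suf, hs, hpe⟩ := mem_pathNodes _ _ _ hmem
    have g := g3 hl pre (suf ++ [e]) (by simp [hs]) (by simp) (by rw [hpe, hend])
    by_cases hb : Behind ρ ρ' ((effectsOf (suf ++ [e])).1 : ℝ) ((effectsOf (suf ++ [e])).2 : ℝ)
    · right
      obtain ⟨⟨k1, k2, k3⟩, k4⟩ := g hb
      have hbd := effectsOf_bound N N' (pathEnd v pre) (suf ++ [e]) (by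
        have := hprod
        rw [hs, List.append_assoc, isProdPath_append] at this
        exact this.2)
      have hlen := length_lt N N' C hC v steps h1 h2
      have hlen2 : (suf ++ [e]).length ≤ C := by
        rw [hs] at hlen
        simp at hlen ⊢; omega
      generalize (effectsOf (suf ++ [e])).1 = x at *
      generalize (effectsOf (suf ++ [e])).2 = y at *
      have hx0 : 0 ≤ x := by exact_mod_cast k1
      have hy0 : 0 ≤ y := by exact_mod_cast k2
      lift x to ℕ using hx0
      lift y to ℕ using hy0
      unfold Behind at hb
      push_cast at hb k1 k2 k3 k4
      have hx : 0 < x := by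
        rcases Nat.eq_zero_or_pos x with h0 | h0
        · subst h0
          have := mul_nonneg hρ.le k2
          simp at hb
          linarith
        · exact h0
      have hxr : (0 : ℝ) < x := by exact_mod_cast hx
      refine ⟨x, y, hx, by omega, by omega, ?_, trivial, by simp [pathNodes], ?_⟩
      · rw [div_lt_div_iff₀ hxr hρ]; linarith
      · intro q1 q2 hq
        have : q1 = [] := by
          have := hq.symm
          simp at this
          exact this.1
        subst this
        simpa using k4
    · left
      refine ⟨pre, ?_, hpe, ?_⟩
      · apply RPath.prefix (l' := suf)
        rw [← hs]; exact ⟨h1, h2, h3⟩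
      · have : wt (ρ' / ρ) (suf ++ [e]) ≥ 0 := by
          unfold Behind at hb
          unfold wt
          push Not at hb
          have h5 : ρ' / ρ * ((effectsOf (suf ++ [e])).1 : ℝ)
              = (ρ' * ((effectsOf (suf ++ [e])).1 : ℝ)) / ρ := by ring
          rw [h5, ge_iff_le, sub_nonneg, div_le_iff₀ hρ]
          linarith
        rw [wt_append] at this
        rw [hs, wt_append]
        linarith
  · left
    have hnl : ¬ IsLasso v (steps ++ [e]) := by
      rintro ⟨_, _, h⟩
      rw [hend] at h
      simp at h
      exact hmem h
    refine ⟨steps ++ [e], ⟨hprod, ?_, ?_⟩, hend, ?_⟩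
    · rw [pathNodes_append, List.nodup_append]
      refine ⟨h2, by simp, ?_⟩
      intro x hx y hy hxy
      simp [stepTgt, he] at hy
      subst hxy; subst hy
      exact hmem hx
    · intro pre suf hps
      rcases List.eq_nil_or_concat suf with h0 | ⟨suf', z, h0⟩
      · subst h0
        simp at hps
        rw [← hps]; exact g2 hnl
      · rw [h0, List.concat_eq_append, ← List.append_assoc] at hps
        have := List.append_inj_left' hps rfl
        exact h3 pre suf' this
    · rw [wt_append, hwe]

/-- `u` is reachable at level `s` with weight `x` -/
def Reach (N : OCN Q A) (N' : OCN Q' A) (s : ℝ) (u : Q × Q') (x : ℝ) : Prop :=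
  ∃ v steps ρ ρ', 0 < ρ ∧ 0 ≤ ρ' ∧ ρ' / ρ = s ∧ RPath N N' v steps ρ ρ' ∧
    pathEnd v steps = u ∧ wt s steps = x

lemma reach_finite (N : OCN Q A) (N' : OCN Q' A) (C : ℕ)
    (hC : IsGreatest (AcyclicLenSet N N') C) (s : ℝ) (u : Q × Q') :
    {x | Reach N N' s u x}.Finite := by
  have hf : (Set.Icc (-(C : ℤ)) C ×ˢ Set.Icc (-(C : ℤ)) C).Finite :=
    (Set.finite_Icc _ _).prod (Set.finite_Icc _ _)
  refine (hf.image (fun z : ℤ × ℤ => (z.2 : ℝ) - s * (z.1 : ℝ))).subset ?_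
  rintro x ⟨v, l, ρ, ρ', _, _, _, h, _, hx⟩
  have h1 := effectsOf_bound N N' v l h.1
  have h2 := length_lt N N' C hC v l h.1 h.2.1
  refine ⟨effectsOf l, ?_, hx⟩
  simp only [Set.mem_prod, Set.mem_Icc]
  omega

lemma exists_potential (N : OCN Q A) (N' : OCN Q' A) (C : ℕ)
    (hC : IsGreatest (AcyclicLenSet N N') C) (v₀ : Q × Q') (ρ ρ' : ℝ) (hρ : 0 < ρ)
    (hρ' : 0 ≤ ρ') (hwin : SlopeDupWins N N' v₀ [] ρ ρ') :
    ∃ (E : Q × Q' → Prop) (lev f : Q × Q' → ℝ), E v₀ ∧ lev v₀ ≤ ρ' / ρ ∧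
      (∀ u, E u → 0 ≤ lev u) ∧
      ∀ u, E u → ∀ a d q, N.δ u.1 a d q → ∃ d' q', N'.δ u.2 a d' q' ∧ E (q, q') ∧
        (lev (q, q') < lev u ∨
          (lev (q, q') = lev u ∧ f (q, q') ≤ f u + ((d' : ℝ) - lev u * (d : ℝ)))) := by
  classical
  let S : Set ℝ := insert (ρ' / ρ)
    ((fun z : ℕ × ℕ => (z.2 : ℝ) / (z.1 : ℝ)) '' (Set.Iic C ×ˢ Set.Iic C))
  have hS : S.Finite := (((Set.finite_Iic _).prod (Set.finite_Iic _)).image _).insert _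
  let L : Q × Q' → Set ℝ := fun u => {s | s ∈ S ∧ ∃ x, Reach N N' s u x}
  have hL : ∀ u, (L u).Finite := fun u => hS.subset fun s hs => hs.1
  have hmin : ∀ u, ∃ s x, (L u).Nonempty →
      s ∈ L u ∧ (∀ t ∈ L u, s ≤ t) ∧ Reach N N' s u x ∧ ∀ y, Reach N N' s u y → x ≤ y := by
    intro u
    by_cases hne : (L u).Nonempty
    · obtain ⟨s, hs, hs'⟩ := Set.exists_min_image (L u) id (hL u) hne
      obtain ⟨x, hx, hx'⟩ := Set.exists_min_image {x | Reach N N' s u x} id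
        (reach_finite N N' C hC s u) hs.2
      exact ⟨s, x, fun _ => ⟨hs, hs', hx, hx'⟩⟩
    · exact ⟨0, 0, fun h => absurd h hne⟩
  choose lev f hlf using hmin
  have h0 : ρ' / ρ ∈ L v₀ := by
    refine ⟨Set.mem_insert _ _, _, v₀, [], ρ, ρ', hρ, hρ', rfl, ⟨trivial, by simp [pathNodes], ?_⟩,
      rfl, rfl⟩
    intro q1 q2 hq
    have : q1 = [] := by
      have := hq.symm
      simp at this
      exact this.1
    subst this
    exact hwin
  refine ⟨fun u => (L u).Nonempty, lev, f, ⟨_, h0⟩, (hlf v₀ ⟨_, h0⟩).2.1 _ h0, ?_, ?_⟩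
  · intro u hu
    obtain ⟨_, _, ⟨_, _, σ, σ', k1, k2, k3, _⟩, _⟩ := hlf u hu
    rw [← k3]; positivity
  · intro u hu a d q hd
    obtain ⟨hlS, _, ⟨v, l, σ, σ', k1, k2, k3, k4, k5, k6⟩, _⟩ := hlf u hu
    rw [← k5] at hd
    obtain ⟨d', q', g1, g2⟩ := rpath_step N N' C hC v l σ σ' k1 k2 k4 a d q hd
    rw [k5] at g1
    refine ⟨d', q', g1, ?_⟩
    rcases g2 with ⟨l2, m1, m2, m3⟩ | ⟨i, j, m1, m2, m3, m4, m5⟩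
    · rw [k3] at m3
      have hr : Reach N N' (lev u) (q, q') (wt (lev u) l2) :=
        ⟨v, l2, σ, σ', k1, k2, k3, m1, m2, rfl⟩
      have hin : lev u ∈ L (q, q') := ⟨hlS.1, _, hr⟩
      obtain ⟨_, n2, _, n4⟩ := hlf (q, q') ⟨_, hin⟩
      refine ⟨⟨_, hin⟩, ?_⟩
      rcases lt_or_eq_of_le (n2 _ hin) with h | h
      · exact Or.inl h
      · right
        refine ⟨h, ?_⟩
        rw [← h] at hr
        have := n4 _ hr
        rw [h] at this
        linarith
    · have hir : (0 : ℝ) < i := by exact_mod_cast m1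
      have hin : (j : ℝ) / (i : ℝ) ∈ L (q, q') := by
        refine ⟨Set.mem_insert_of_mem _ ⟨(i, j), ⟨m2, m3⟩, rfl⟩, _, (q, q'), [], i, j, hir,
          by positivity, rfl, m5, rfl, rfl⟩
      refine ⟨⟨_, hin⟩, Or.inl ?_⟩
      have := (hlf (q, q') ⟨_, hin⟩).2.1 _ hin
      rw [k3] at m4
      linarith

end Helpers

/-- If Duplicator wins the slope game from position
`((p, p'), (ρ, ρ'))`, then Duplicator wins the simulation game (i.e. strong
simulation `pm ⪯ p'm'` holds) from every position `(pm, p'm')` such that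
`(m, m')` is `C`-above `(ρ, ρ')`, where `C` is 1 plus the maximal length of
an acyclic path in the product graph of the two nets (in normal form). -/
theorem duplicator_transfer {Q Q' A : Type} [Fintype Q] [Fintype Q'] [Fintype A]
    (N : OCN Q A) (N' : OCN Q' A)
    (hN : N.NonBlocking) (hN' : N'.Complete)
    (C : ℕ) (hC : IsGreatest (AcyclicLenSet N N') C)
    (p : Q) (p' : Q') (ρ ρ' : ℝ) (hpos : PosVec ρ ρ')
    (hwin : SlopeDupWins N N' (p, p') [] ρ ρ') :
    ∀ m m' : ℕ, CAbove (C : ℝ) ρ ρ' (m : ℤ) (m' : ℤ) →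
      Simulates N.Step N'.Step (p, m) (p', m') := by
  intro m m' ⟨r, hr, hm, hm'⟩
  push_cast at hm hm'
  have hρ' : 0 ≤ ρ' := hpos.2.1
  have hρ : 0 < ρ := by
    rcases lt_or_eq_of_le hpos.1 with h | h
    · exact h
    · rw [← h] at hm
      have h1 : (0 : ℝ) ≤ m := Nat.cast_nonneg m
      have h2 : (0 : ℝ) ≤ C := Nat.cast_nonneg C
      linarith
  obtain ⟨E, lev, f, hE0, hlev0, hlevpos, hstep⟩ :=
    exists_potential N N' C hC (p, p') ρ ρ' hρ hρ' hwin
  refine ⟨fun c c' => ∃ (v : Q × Q') (τ : List (PStep Q Q' A)) (b b' : ℤ),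
    IsProdPath N N' v τ ∧ (pathNodes v τ).Nodup ∧ pathEnd v τ = (c.1, c'.1) ∧ E (c.1, c'.1) ∧
    (c.2 : ℤ) = b + (effectsOf τ).1 ∧ (c'.2 : ℤ) = b' + (effectsOf τ).2 ∧
    lev (c.1, c'.1) * ((b : ℝ) + C) < (b' : ℝ) - C ∧
    (∀ t1 t2 t3, τ = t1 ++ t2 ++ t3 →
      lev (pathEnd v (t1 ++ t2)) ≤ lev (pathEnd v t1) ∧
      (lev (pathEnd v (t1 ++ t2)) = lev (pathEnd v t1) →
        f (pathEnd v (t1 ++ t2)) ≤ f (pathEnd v t1) + wt (lev (pathEnd v t1)) t2)), ?_, ?_⟩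
  · rintro ⟨q, n⟩ ⟨q', n'⟩ ⟨v, τ, b, b', h1, h2, h3, h4, h5, h6, h7, h8⟩ a ⟨q2, n2⟩ ⟨d, hd, hn2⟩
    simp only at h3 h4 h5 h6 h7 hd hn2
    obtain ⟨d', q2', g1, g2, g3⟩ := hstep (q, q') h4 a d q2 hd
    simp only at g1
    set e : PStep Q Q' A := (a, d, d', (q2, q2')) with he
    have hend : pathEnd v (τ ++ [e]) = (q2, q2') := by
      rw [pathEnd_append]; simp [pathEnd, stepTgt, he]
    have hprod : IsProdPath N N' v (τ ++ [e]) := by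
      rw [isProdPath_append, h3]
      exact ⟨h1, hd, g1, trivial⟩
    have hbd1 := effectsOf_bound N N' v τ h1
    have hbd := effectsOf_bound N N' v _ hprod
    have hlen := length_lt N N' C hC v τ h1 h2
    have heff1 : (effectsOf (τ ++ [e])).1 = (effectsOf τ).1 + d := by
      rw [effectsOf_append]; simp [effectsOf, he]
    have heff2 : (effectsOf (τ ++ [e])).2 = (effectsOf τ).2 + d' := by
      rw [effectsOf_append]; simp [effectsOf, he]
    rw [heff1, heff2] at hbd
    simp only [List.length_append, List.length_singleton] at hbd
    push_cast at hbd
    have hbC : 0 < b + C := by omega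
    have hbCr : (0 : ℝ) < (b : ℝ) + C := by exact_mod_cast hbC
    have hb' : (C : ℤ) < b' := by
      have := mul_nonneg (hlevpos _ h4) hbCr.le
      have h9 : (C : ℝ) < b' := by linarith
      exact_mod_cast h9
    have hnn : 0 ≤ (n' : ℤ) + d' := by omega
    obtain ⟨n2', hn2'⟩ := Int.eq_ofNat_of_zero_le hnn
    have hlevle : lev (q2, q2') ≤ lev (q, q') := by
      rcases g3 with h | h
      · exact h.le
      · exact h.1.le
    -- segment property for the extended path
    have hseg : ∀ t1 t2 t3, τ ++ [e] = t1 ++ t2 ++ t3 →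
      lev (pathEnd v (t1 ++ t2)) ≤ lev (pathEnd v t1) ∧
      (lev (pathEnd v (t1 ++ t2)) = lev (pathEnd v t1) →
        f (pathEnd v (t1 ++ t2)) ≤ f (pathEnd v t1) + wt (lev (pathEnd v t1)) t2) := by
      intro t1 t2 t3 ht
      rcases List.eq_nil_or_concat t3 with h0 | ⟨t3', z, h0⟩
      · subst h0
        rw [List.append_nil] at ht
        rcases List.eq_nil_or_concat t2 with h0 | ⟨t2', z, h0⟩
        · subst h0
          simp [wt, effectsOf]
        · rw [List.concat_eq_append] at h0
          rw [← ht, hend]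
          rw [h0, ← List.append_assoc] at ht
          have i1 := List.append_inj_left' ht rfl
          have i2 := List.append_inj_right' ht rfl
          have hh := h8 t1 t2' [] (by simpa using i1)
          rw [← i1, h3] at hh
          refine ⟨hlevle.trans hh.1, fun heq => ?_⟩
          have hq : lev (q, q') = lev (pathEnd v t1) := le_antisymm hh.1 (heq ▸ hlevle)
          have hf := hh.2 hq
          rcases g3 with g | ⟨g, g'⟩
          · rw [heq, hq] at g; exact absurd g (lt_irrefl _)
          · rw [h0, wt_append, ← i2, wt_single]
            rw [hq] at g'
            simp only [he]
            linarith
      · rw [h0, List.concat_eq_append, ← List.append_assoc] at ht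
        exact h8 t1 t2 t3' (List.append_inj_left' ht rfl)
    refine ⟨(q2', n2'), ⟨d', g1, by simpa using hn2'.symm⟩, ?_⟩
    by_cases hmem : (q2, q2') ∈ pathNodes v τ
    · obtain ⟨t1, t2, ht, hpe⟩ := mem_pathNodes _ _ _ hmem
      have hs1 := hseg t1 (t2 ++ [e]) [] (by simp [ht])
      have happ : t1 ++ (t2 ++ [e]) = τ ++ [e] := by simp [ht]
      rw [happ, hend, hpe] at hs1
      have hw := hs1.2 rfl
      have hs2 := h8 t1 t2 [] (by simp [ht])
      rw [← ht, h3, hpe] at hs2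
      have hlq : lev (q2, q2') = lev (q, q') := le_antisymm hlevle hs2.1
      have hE1 : (effectsOf τ).1 = (effectsOf t1).1 + (effectsOf t2).1 := by
        rw [ht, effectsOf_append]
      have hE2 : (effectsOf τ).2 = (effectsOf t1).2 + (effectsOf t2).2 := by
        rw [ht, effectsOf_append]
      rw [wt_append, wt_single] at hw
      simp only [he, wt] at hw
      refine ⟨v, t1, b + ((effectsOf t2).1 + d), b' + ((effectsOf t2).2 + d'), ?_, ?_, hpe, g2,
        ?_, ?_, ?_, ?_⟩
      · rw [ht, isProdPath_append] at h1; exact h1.1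
      · rw [ht, pathNodes_append] at h2
        exact (List.nodup_append.1 h2).1
      · simp only; omega
      · simp only; omega
      · simp only
        push_cast
        rw [← hlq] at h7
        linarith
      · intro s1 s2 s3 hs
        exact h8 s1 s2 (s3 ++ t2) (by rw [ht, hs]; simp)
    · refine ⟨v, τ ++ [e], b, b', hprod, ?_, hend, g2, ?_, ?_, ?_, hseg⟩
      · rw [pathNodes_append, List.nodup_append]
        refine ⟨h2, by simp, ?_⟩
        intro x hx y hy hxy
        simp [stepTgt, he] at hy
        subst hxy; subst hy
        exact hmem hx
      · rw [heff1]; simp only; omega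
      · rw [heff2]; simp only; omega
      · simp only
        have := mul_le_mul_of_nonneg_right hlevle hbCr.le
        linarith
  · refine ⟨(p, p'), [], m, m', trivial, by simp [pathNodes], rfl, hE0, by simp [effectsOf],
      by simp [effectsOf], ?_, ?_⟩
    · simp only
      push_cast
      have h1 : (0 : ℝ) ≤ m := Nat.cast_nonneg m
      have h2 : (0 : ℝ) ≤ C := Nat.cast_nonneg C
      have h3 := mul_le_mul_of_nonneg_right hlev0 (add_nonneg h1 h2)
      have h4 : ρ' / ρ * ((m : ℝ) + C) ≤ ρ' / ρ * (r * ρ) :=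
        mul_le_mul_of_nonneg_left (by linarith) (by positivity)
      have h5 : ρ' / ρ * (r * ρ) = r * ρ' := by field_simp
      linarith
    · intro t1 t2 t3 ht
      have := ht.symm
      simp at this
      obtain ⟨rfl, rfl, rfl⟩ := this
      simp [wt, effectsOf]
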